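/- arXiv:2604.05916 — 4 statements merged into one kernel-verified Lean document; each statement's English description precedes it below -/
import Mathlib

section
/- Let m ≥ 3 and let s' be a score vector that is not the Borda score vector. Then for every score vector s, the scoring rule f^s CL-dominates f^{s'} if and only if s is the Borda score vector s^B. -/
open Finset

/-- A preference profile over `m` alternatives with `n` voters: voter `i`'s linear
order `≿_i` is encoded by the bijection `P i` sending each alternative to its
0-indexed rank (rank `0` = first, rank `m-1` = last); thus `y ≿_i x` iff
`P i y ≤ P i x`, and the 1-indexed rank is `r(x, ≿_i) = (P i x : ℕ) + 1`. -/
abbrev Profile (m n : ℕ) := Fin n → (Fin m ≃ Fin m)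

/-- `s` is a score vector for `m` alternatives: entries in `[0,1]`, weakly
decreasing, first entry `1`, last entry `0` (index `k : Fin m` corresponds to
the 1-indexed rank `k + 1`). -/
def IsScoreVec {m : ℕ} (s : Fin m → ℝ) : Prop :=
  Antitone s ∧ (∀ k, 0 ≤ s k ∧ s k ≤ 1) ∧
    (∀ k : Fin m, (k : ℕ) = 0 → s k = 1) ∧
    (∀ k : Fin m, (k : ℕ) = m - 1 → s k = 0)

/-- The Borda score vector: 1-indexed, `s^B(k) = (m - k)/(m - 1)`, i.e.
0-indexed, `k ↦ (m - 1 - k)/(m - 1)`. -/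
noncomputable def bordaVec (m : ℕ) : Fin m → ℝ :=
  fun k => ((m : ℝ) - 1 - (k : ℕ)) / ((m : ℝ) - 1)

/-- Total score `∑_{i ∈ N} s(r(x, ≿_i))` of alternative `x` at profile `P`. -/
noncomputable def score {m n : ℕ} (s : Fin m → ℝ) (P : Profile m n) (x : Fin m) : ℝ :=
  ∑ i, s (P i x)

/-- The choice set `f^s(≿)` of the scoring rule with score vector `s`. -/
def winners {m n : ℕ} (s : Fin m → ℝ) (P : Profile m n) : Set (Fin m) :=
  {x | ∀ y, score s P y ≤ score s P x}

/-- `x` is a Condorcet loser at `P`: for every `y ≠ x`,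
`|{i : y ≿_i x}| > |{i : x ≿_i y}|`. -/
def CondorcetLoser {m n : ℕ} (P : Profile m n) (x : Fin m) : Prop :=
  ∀ y, y ≠ x →
    (univ.filter fun i => P i x ≤ P i y).card <
      (univ.filter fun i => P i y ≤ P i x).card

/-- `L(f^s)`: the set of (nonempty-electorate) preference profiles at which the
scoring rule `f^s` selects at least one Condorcet loser. -/
def Lset {m : ℕ} (s : Fin m → ℝ) : Set ((n : ℕ) × Profile m n) :=
  {P | 0 < P.1 ∧ ∃ x ∈ winners s P.2, CondorcetLoser P.2 x}

/-- The pairwise comparison of two ranks: `1` if `i` is better than `j`, `-1` if it is worse,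
and `0` if they coincide. -/
noncomputable def rankSign {m : ℕ} (i j : Fin m) : ℝ :=
  (if i ≤ j then 1 else 0) - (if j ≤ i then 1 else 0)

lemma rankSign_self {m : ℕ} (i : Fin m) : rankSign i i = 0 := by
  simp [rankSign]

lemma rankSign_swap {m : ℕ} (i j : Fin m) : rankSign j i = -rankSign i j := by
  simp [rankSign]

lemma sum_rankSign {m : ℕ} (i : Fin m) :
    ∑ j, rankSign i j = (m : ℝ) - 1 - 2 * (i : ℕ) := by
  have h₁ : (univ.filter fun j : Fin m => i ≤ j) = Finset.Ici i := by ext; simp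
  have h₂ : (univ.filter fun j : Fin m => j ≤ i) = Finset.Iic i := by ext; simp
  simp only [rankSign, sum_sub_distrib, sum_boole, h₁, h₂, Fin.card_Ici, Fin.card_Iic]
  rw [Nat.cast_sub i.2.le]
  push_cast
  ring

lemma sum_rankSign_eq_borda {m : ℕ} (hm : 3 ≤ m) (i : Fin m) :
    ∑ j, rankSign i j = ((m : ℝ) - 1) * (2 * bordaVec m i - 1) := by
  have hm' : (3 : ℝ) ≤ m := by exact_mod_cast hm
  have : (m : ℝ) - 1 ≠ 0 := by linarith
  rw [sum_rankSign, bordaVec]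
  field_simp
  ring

lemma sum_rankSign_profile {m n : ℕ} (P : Profile m n) (x y : Fin m) :
    ∑ i, rankSign (P i x) (P i y) =
      ((univ.filter fun i => P i x ≤ P i y).card : ℝ) -
        ((univ.filter fun i => P i y ≤ P i x).card : ℝ) := by
  simp [rankSign, sum_sub_distrib]

lemma condorcetLoser_iff {m n : ℕ} (P : Profile m n) (x : Fin m) :
    CondorcetLoser P x ↔ ∀ y, y ≠ x → ∑ i, rankSign (P i x) (P i y) < 0 := by
  simp only [CondorcetLoser, sum_rankSign_profile, sub_neg, Nat.cast_lt]

lemma CondorcetLoser.unique {m n : ℕ} {P : Profile m n} {x y : Fin m}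
    (hx : CondorcetLoser P x) (hy : CondorcetLoser P y) : x = y := by
  by_contra h
  exact lt_asymm (hx y (Ne.symm h)) (hy x h)

/-- The Borda rule never selects a Condorcet loser. -/
lemma Lset_bordaVec {m : ℕ} (hm : 3 ≤ m) : Lset (bordaVec m) = ∅ := by
  rw [Set.eq_empty_iff_forall_notMem]
  rintro ⟨n, P⟩ ⟨-, x, hx, hc⟩
  dsimp only at hx hc
  rw [condorcetLoser_iff] at hc
  have hm' : (3 : ℝ) ≤ m := by exact_mod_cast hm
  have key : ∀ z, ∑ y, ∑ i, rankSign (P i z) (P i y) =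
      ((m : ℝ) - 1) * (2 * score (bordaVec m) P z - n) := by
    intro z
    rw [sum_comm]
    have : ∀ i, ∑ y, rankSign (P i z) (P i y) =
        ((m : ℝ) - 1) * (2 * bordaVec m (P i z) - 1) := fun i => by
      rw [← sum_rankSign_eq_borda hm]
      exact Equiv.sum_comp (P i) fun j => rankSign (P i z) j
    simp only [this, score, ← mul_sum, sum_sub_distrib]
    simp
  have hneg : ∑ y, ∑ i, rankSign (P i x) (P i y) < 0 := by
    have : Nontrivial (Fin m) := Fin.nontrivial_iff_two_le.2 (by omega)
    obtain ⟨y, hy⟩ := exists_ne x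
    refine sum_neg' (fun z _ => ?_) ⟨y, mem_univ y, hc y hy⟩
    rcases eq_or_ne z x with rfl | hz
    · simp [rankSign_self]
    · exact (hc z hz).le
  have hall : ∀ z, ∑ y, ∑ i, rankSign (P i z) (P i y) < 0 := by
    intro z
    have hle : score (bordaVec m) P z ≤ score (bordaVec m) P x := hx z
    rw [key] at hneg ⊢
    nlinarith
  have htotal : ∑ z, ∑ y, ∑ i, rankSign (P i z) (P i y) < 0 :=
    sum_neg (fun z _ => hall z) ⟨x, mem_univ x⟩
  have hanti : ∑ z, ∑ y, ∑ i, rankSign (P i z) (P i y) =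
      -∑ z, ∑ y, ∑ i, rankSign (P i z) (P i y) := by
    conv_lhs => rw [sum_comm]
    simp only [← sum_neg_distrib]
    exact sum_congr rfl fun z _ => sum_congr rfl fun y _ => sum_congr rfl fun i _ =>
      rankSign_swap _ _
  linarith

/-- Finitely many strict linear inequalities that are insensitive to adding a constant
and have a real solution have a solution in natural numbers. -/
lemma exists_nat_weights {Ω ι : Type*} [Fintype Ω] [Finite ι] (c : ι → Ω → ℝ) (w : Ω → ℝ)
    (hc : ∀ j, ∑ a, c j a = 0) (hw : ∀ j, 0 < ∑ a, w a * c j a) :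
    ∃ k : Ω → ℕ, ∀ j, 0 < ∑ a, (k a : ℝ) * c j a := by
  obtain ⟨C, hC⟩ : ∃ C : ℝ, ∀ a, 0 ≤ w a + C := by
    obtain ⟨B, hB⟩ := (Set.finite_range w).bddBelow
    exact ⟨-B, fun a => by linarith [hB (Set.mem_range_self a)]⟩
  have hlim : ∀ j, Filter.Tendsto
      (fun N : ℝ => ∑ a, ((⌊(w a + C) * N⌋₊ : ℝ) / N) * c j a) Filter.atTop
      (nhds (∑ a, (w a + C) * c j a)) := fun j =>
    tendsto_finsetSum _ fun a _ => (tendsto_nat_floor_mul_div_atTop (hC a)).mul_const _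
  have hpos : ∀ j, 0 < ∑ a, (w a + C) * c j a := fun j => by
    simp only [add_mul, sum_add_distrib, ← mul_sum, hc, mul_zero, add_zero]
    exact hw j
  have hev : ∀ᶠ N : ℝ in Filter.atTop, ∀ j,
      0 < ∑ a, ((⌊(w a + C) * N⌋₊ : ℝ) / N) * c j a :=
    Filter.eventually_all.2 fun j => (hlim j).eventually_const_lt (hpos j)
  obtain ⟨N, hN, hN0⟩ := (hev.and (Filter.eventually_gt_atTop 0)).exists
  refine ⟨fun a => ⌊(w a + C) * N⌋₊, fun j => ?_⟩
  have h := mul_pos hN0 (hN j)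
  rw [mul_sum] at h
  refine h.trans_eq (sum_congr rfl fun a _ => ?_)
  field_simp

/-- A profile in which each order has a prescribed multiplicity. -/
lemma exists_profile_of_multiplicity {m : ℕ} (k : Equiv.Perm (Fin m) → ℕ) :
    ∃ (n : ℕ) (P : Profile m n), ∀ F : Equiv.Perm (Fin m) → ℝ,
      ∑ i, F (P i) = ∑ σ, (k σ : ℝ) * F σ := by
  let e := Fintype.equivFin (Σ σ : Equiv.Perm (Fin m), Fin (k σ))
  refine ⟨_, fun i => (e.symm i).1, fun F => ?_⟩
  rw [Equiv.sum_comp e.symm fun a => F a.1, Fintype.sum_sigma]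
  simp

lemma sum_perm_swap {m : ℕ} (x y : Fin m) (F : Equiv.Perm (Fin m) → ℝ) :
    ∑ σ, F (σ * Equiv.swap x y) = ∑ σ, F σ :=
  Equiv.sum_comp (Equiv.mulRight (Equiv.swap x y)) F

/-- A signed weighting of the orders at which `x` is a Condorcet loser, is the unique winner
under `s`, and is beaten by `y` under `t` yields a profile separating the two rules. -/
lemma not_Lset_subset_of_weights {m : ℕ} (s t : Fin m → ℝ) (x y : Fin m)
    (w : Equiv.Perm (Fin m) → ℝ)
    (hs : ∀ z, z ≠ x → 0 < ∑ σ, w σ * (s (σ x) - s (σ z)))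
    (hM : ∀ z, z ≠ x → 0 < ∑ σ, w σ * rankSign (σ z) (σ x))
    (ht : 0 < ∑ σ, w σ * (t (σ y) - t (σ x))) :
    ¬ Lset s ⊆ Lset t := by
  have hdiff : ∀ (f : Fin m → ℝ) (a b : Fin m),
      ∑ σ : Equiv.Perm (Fin m), (f (σ a) - f (σ b)) = 0 := by
    intro f a b
    have h := sum_perm_swap a b fun σ => f (σ a)
    simp only [Equiv.Perm.mul_apply, Equiv.swap_apply_left] at h
    rw [sum_sub_distrib, h, sub_self]
  have hsign : ∀ a b : Fin m, ∑ σ : Equiv.Perm (Fin m), rankSign (σ a) (σ b) = 0 := by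
    intro a b
    have h := sum_perm_swap a b fun σ => rankSign (σ a) (σ b)
    simp only [Equiv.Perm.mul_apply, Equiv.swap_apply_left, Equiv.swap_apply_right] at h
    simp only [fun σ : Equiv.Perm (Fin m) => rankSign_swap (σ a) (σ b), sum_neg_distrib] at h
    linarith
  obtain ⟨k, hk⟩ := exists_nat_weights
    (Sum.elim (fun (z : {z // z ≠ x}) (σ : Equiv.Perm (Fin m)) => s (σ x) - s (σ z))
      (Sum.elim (fun (z : {z // z ≠ x}) (σ : Equiv.Perm (Fin m)) => rankSign (σ z) (σ x))
        (fun (_ : Unit) (σ : Equiv.Perm (Fin m)) => t (σ y) - t (σ x)))) w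
    (by
      rintro (z | z | z)
      · exact hdiff s x z
      · exact hsign z x
      · exact hdiff t y x)
    (by
      rintro (z | z | z)
      · exact hs z z.2
      · exact hM z z.2
      · exact ht)
  obtain ⟨n, P, hP⟩ := exists_profile_of_multiplicity k
  have hks : ∀ z, z ≠ x → score s P z < score s P x := fun z hz => by
    have h := hk (Sum.inl ⟨z, hz⟩)
    simp only [Sum.elim_inl, ← hP fun σ => s (σ x) - s (σ z), sum_sub_distrib] at h
    exact sub_pos.1 h
  have hkM : CondorcetLoser P x := by
    rw [condorcetLoser_iff]
    intro z hz
    have h := hk (Sum.inr (Sum.inl ⟨z, hz⟩))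
    simp only [Sum.elim_inl, Sum.elim_inr, ← hP fun σ => rankSign (σ z) (σ x)] at h
    simp only [fun i => rankSign_swap (P i z) (P i x), sum_neg_distrib]
    linarith
  have hkt : score t P x < score t P y := by
    have h := hk (Sum.inr (Sum.inr ()))
    simp only [Sum.elim_inr, ← hP fun σ => t (σ y) - t (σ x), sum_sub_distrib] at h
    exact sub_pos.1 h
  have hn : 0 < n := by
    rcases Nat.eq_zero_or_pos n with rfl | h
    · simp [score] at hkt
    · exact h
  intro hsub
  obtain ⟨-, x', hx', hc'⟩ : (⟨n, P⟩ : (n : ℕ) × Profile m n) ∈ Lset t := by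
    refine hsub ⟨hn, x, fun z => ?_, hkM⟩
    rcases eq_or_ne z x with rfl | hz
    · exact le_rfl
    · exact (hks z hz).le
  obtain rfl := hkM.unique hc'
  exact absurd (hx' y) (not_le.2 hkt)

lemma exists_perm_apply_pair {α : Type*} [DecidableEq α] {x y a b : α} (hxy : x ≠ y)
    (hab : a ≠ b) : ∃ τ : Equiv.Perm α, τ x = a ∧ τ y = b := by
  refine ⟨Equiv.swap (Equiv.swap x a y) b * Equiv.swap x a, ?_, ?_⟩
  · rw [Equiv.Perm.mul_apply, Equiv.swap_apply_left]
    refine Equiv.swap_apply_of_ne_of_ne (fun h => hxy ?_) hab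
    apply (Equiv.swap x a).injective
    rw [Equiv.swap_apply_left, ← h]
  · rw [Equiv.Perm.mul_apply, Equiv.swap_apply_left]

/-- Summing over all permutations a function of the images of two distinct points amounts, up to
a positive factor, to summing over all pairs of distinct points. -/
lemma exists_sum_perm_pair {m : ℕ} {x y : Fin m} (hxy : x ≠ y) :
    ∃ c : ℝ, 0 < c ∧ ∀ G : Fin m → Fin m → ℝ,
      ∑ σ : Equiv.Perm (Fin m), G (σ x) (σ y) = c * (∑ i, ∑ j, G i j - ∑ i, G i i) := by
  set c : ℝ := ((univ.filter fun σ : Equiv.Perm (Fin m) => σ x = x ∧ σ y = y).card : ℝ)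
  have hcard : ∀ i j : Fin m, i ≠ j →
      ((univ.filter fun σ : Equiv.Perm (Fin m) => σ x = i ∧ σ y = j).card : ℝ) = c := by
    intro i j hij
    obtain ⟨τ, hτx, hτy⟩ := exists_perm_apply_pair hxy hij
    refine congrArg Nat.cast (Finset.card_equiv (Equiv.mulLeft τ⁻¹) fun σ => ?_)
    simp [Equiv.symm_apply_eq, hτx, hτy]
  refine ⟨c, ?_, fun G => ?_⟩
  · exact Nat.cast_pos.2 (Finset.card_pos.2 ⟨1, by simp⟩)
  · have hfib : ∀ σ : Equiv.Perm (Fin m), G (σ x) (σ y) =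
        ∑ i, ∑ j, if σ x = i ∧ σ y = j then G i j else 0 := by
      intro σ
      simp [ite_and]
    simp only [hfib]
    rw [sum_comm]
    have hsplit : ∀ i, ∑ σ : Equiv.Perm (Fin m), ∑ j, (if σ x = i ∧ σ y = j then G i j else 0) =
        c * (∑ j, G i j - G i i) := by
      intro i
      rw [sum_comm, ← Finset.sum_erase_eq_sub (mem_univ i), mul_sum,
        ← Finset.add_sum_erase _ _ (mem_univ i)]
      have hdiag : ∑ σ : Equiv.Perm (Fin m), (if σ x = i ∧ σ y = i then G i i else 0) = 0 :=
        sum_eq_zero fun σ _ => if_neg fun h => hxy (σ.injective (h.1.trans h.2.symm))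
      rw [hdiag, zero_add]
      refine sum_congr rfl fun j hj => ?_
      rw [← sum_filter, sum_const, nsmul_eq_mul, hcard i j (Finset.ne_of_mem_erase hj).symm]
    simp only [hsplit, ← mul_sum, sum_sub_distrib]

/-- If all values of `A` outside `x` and `y` coincide, the total determines them. -/
lemma sum_eq_add_add_mul {m : ℕ} {x y z : Fin m} (hxy : x ≠ y) (A : Fin m → ℝ)
    (hA : ∀ z', z' ≠ x → z' ≠ y → A z' = A z) :
    ∑ z', A z' = A x + A y + ((m : ℝ) - 2) * A z := by
  have h : ∀ z', A z' = A z + ((if z' = x then A x - A z else 0) +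
      (if z' = y then A y - A z else 0)) := by
    intro z'
    by_cases h₁ : z' = x
    · subst h₁; simp [hxy]
    · by_cases h₂ : z' = y
      · subst h₂; simp [h₁]
      · simp [h₁, h₂, hA z' h₁ h₂]
  rw [sum_congr rfl fun z' _ => h z']
  simp [sum_add_distrib]
  ring

/-- There is a zero-sum vector separating two distinct score vectors. -/
lemma exists_separating {m : ℕ} (hm : 3 ≤ m) {s t : Fin m → ℝ} (hs : IsScoreVec s)
    (ht : IsScoreVec t) (hst : s ≠ t) :
    ∃ d : Fin m → ℝ, ∑ i, d i = 0 ∧ ∑ i, d i * s i < 0 ∧ 0 < ∑ i, d i * t i := by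
  obtain ⟨k, hk⟩ := Function.ne_iff.1 hst
  obtain ⟨a, ha⟩ : ∃ a : Fin m, (a : ℕ) = 0 := ⟨⟨0, by omega⟩, rfl⟩
  obtain ⟨b, hb⟩ : ∃ b : Fin m, (b : ℕ) = m - 1 := ⟨⟨m - 1, by omega⟩, rfl⟩
  have hsa := hs.2.2.1 a ha
  have hsb := hs.2.2.2 b hb
  have hta := ht.2.2.1 a ha
  have htb := ht.2.2.2 b hb
  set c := (s k + t k) / 2 with hc
  set ε := t k - s k with hε
  have hε0 : ε ≠ 0 := sub_ne_zero.2 (Ne.symm hk)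
  have hε2 : 0 < ε ^ 2 := by positivity
  have hsum : ∀ f : Fin m → ℝ, ∑ i, (ε * ((if i = k then 1 else 0) -
      c * (if i = a then 1 else 0) - (1 - c) * (if i = b then 1 else 0))) * f i =
      ε * (f k - c * f a - (1 - c) * f b) := by
    intro f
    simp only [mul_assoc, sub_mul, ← mul_sum, sum_sub_distrib]
    simp
  refine ⟨fun i => ε * ((if i = k then 1 else 0) -
      c * (if i = a then 1 else 0) - (1 - c) * (if i = b then 1 else 0)), ?_, ?_, ?_⟩
  · have := hsum fun _ => 1
    simp only [mul_one] at this
    rw [this]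
    ring
  · rw [hsum, hsa, hsb, show s k - c * 1 - (1 - c) * 0 = -ε / 2 by rw [hc, hε]; ring]
    nlinarith
  · rw [hsum, hta, htb, show t k - c * 1 - (1 - c) * 0 = ε / 2 by rw [hc, hε]; ring]
    nlinarith

/-- There is a matrix with zero row sums, column sums and diagonal whose total pairwise margin
does not vanish. -/
lemma exists_cyclic {m : ℕ} (hm : 3 ≤ m) :
    ∃ a : Fin m → Fin m → ℝ, (∀ i, ∑ j, a i j = 0) ∧ (∀ j, ∑ i, a i j = 0) ∧
      (∀ i, a i i = 0) ∧ ∑ i, ∑ j, a i j * rankSign i j = 2 := by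
  let e₀ : Fin m := ⟨0, by omega⟩
  let e₁ : Fin m := ⟨1, by omega⟩
  let e₂ : Fin m := ⟨2, by omega⟩
  let p : Fin m → ℝ := fun i => (if i = e₀ then 1 else 0) - (if i = e₂ then 1 else 0)
  let r : Fin m → ℝ := fun i => (if i = e₁ then 1 else 0) - (if i = e₂ then 1 else 0)
  have hp : ∀ f : Fin m → ℝ, ∑ i, p i * f i = f e₀ - f e₂ := fun f => by
    simp [p, sub_mul, sum_sub_distrib]
  have hr : ∀ f : Fin m → ℝ, ∑ i, r i * f i = f e₁ - f e₂ := fun f => by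
    simp [r, sub_mul, sum_sub_distrib]
  have hp0 : ∑ i, p i = 0 := by simpa using hp fun _ => 1
  have hr0 : ∑ i, r i = 0 := by simpa using hr fun _ => 1
  refine ⟨fun i j => p i * r j - r i * p j, fun i => ?_, fun j => ?_, fun i => by ring, ?_⟩
  · simp only [sum_sub_distrib, ← mul_sum, hp0, hr0]; ring
  · simp only [sum_sub_distrib, ← sum_mul, hp0, hr0]; ring
  · simp only [sub_mul, sum_sub_distrib, mul_assoc, ← mul_sum, hp, hr]
    simp [rankSign, e₀, e₁, e₂]
    norm_num

/-- Zero-sum perturbations `q` and `v` of the uniform rank distributions of two alternatives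
yield a profile separating the rules of `s` and `t`. -/
lemma not_Lset_subset_of_rank_vectors {m : ℕ} (hm : 3 ≤ m) (s t q v : Fin m → ℝ)
    (hq : ∑ i, q i = 0) (hv : ∑ i, v i = 0) (hqs : 0 < ∑ i, q i * s i)
    (hvs : ∑ i, v i * s i < ∑ i, q i * s i)
    (hb : ((m : ℝ) - 1) * ∑ i, q i * bordaVec m i < ∑ i, v i * bordaVec m i)
    (hvt : ∑ i, q i * t i < ∑ i, v i * t i) :
    ¬ Lset s ⊆ Lset t := by
  have hm' : (3 : ℝ) ≤ m := by exact_mod_cast hm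
  obtain ⟨x, y, hxy⟩ : ∃ x y : Fin m, x ≠ y :=
    ⟨⟨0, by omega⟩, ⟨1, by omega⟩, by simp⟩
  obtain ⟨c, hc, hpair⟩ := exists_sum_perm_pair hxy
  obtain ⟨a, harow, hacol, hadiag, hasign⟩ := exists_cyclic hm
  -- The coefficient of the cyclic part equalizes the margins of `x` against the others.
  obtain ⟨γ, hγ⟩ : ∃ γ : ℝ, ∑ i, ∑ j, (q i + v j) * rankSign i j + γ * 2 =
      2 * (((m : ℝ) - 1) * ∑ i, q i * bordaVec m i - ∑ i, v i * bordaVec m i) :=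
    ⟨(2 * (((m : ℝ) - 1) * ∑ i, q i * bordaVec m i - ∑ i, v i * bordaVec m i) -
      ∑ i, ∑ j, (q i + v j) * rankSign i j) / 2, by ring⟩
  let w : Equiv.Perm (Fin m) → ℝ := fun σ => q (σ x) + v (σ y) + γ * a (σ x) (σ y)
  have hwx : ∀ f : Fin m → ℝ, ∑ σ, w σ * f (σ x) =
      c * (((m : ℝ) - 1) * ∑ i, q i * f i - ∑ i, v i * f i) := by
    intro f
    rw [hpair fun i j => (q i + v j + γ * a i j) * f i]
    simp only [← sum_mul, sum_add_distrib, ← mul_sum, harow, hv, hadiag, add_mul]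
    simp only [sum_const, card_univ, Fintype.card_fin, nsmul_eq_mul, mul_zero, add_zero,
      zero_mul, mul_assoc, ← mul_sum]
    ring
  have hwy : ∀ f : Fin m → ℝ, ∑ σ, w σ * f (σ y) =
      c * (((m : ℝ) - 1) * ∑ i, v i * f i - ∑ i, q i * f i) := by
    intro f
    rw [hpair fun i j => (q i + v j + γ * a i j) * f j, sum_comm]
    simp only [← sum_mul, sum_add_distrib, ← mul_sum, hacol, hq, hadiag, add_mul]
    simp only [sum_const, card_univ, Fintype.card_fin, nsmul_eq_mul, mul_zero, add_zero,
      zero_mul, zero_add, mul_assoc, ← mul_sum]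
    ring
  have hw0 : ∑ σ, w σ = 0 := by
    have h := hwx fun _ => 1
    simpa [hq, hv] using h
  have hsymm : ∀ (F : Fin m → Fin m → ℝ) (z z' : Fin m), z ≠ x → z ≠ y → z' ≠ x → z' ≠ y →
      ∑ σ, w σ * F (σ x) (σ z') = ∑ σ, w σ * F (σ x) (σ z) := by
    intro F z z' hzx hzy hzx' hzy'
    rw [← sum_perm_swap z z' fun σ => w σ * F (σ x) (σ z)]
    simp [w, Equiv.swap_apply_of_ne_of_ne hzx.symm hzx'.symm,
      Equiv.swap_apply_of_ne_of_ne hzy.symm hzy'.symm]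
  refine not_Lset_subset_of_weights s t x y w (fun z hzx => ?_) (fun z hzx => ?_) ?_
  · simp only [mul_sub, sum_sub_distrib]
    rcases eq_or_ne z y with rfl | hzy
    · rw [hwx, hwy]
      have : 0 < c * (m * (∑ i, q i * s i - ∑ i, v i * s i)) :=
        mul_pos hc (mul_pos (by linarith) (sub_pos.2 hvs))
      linarith
    · have htot := sum_eq_add_add_mul hxy (z := z) (fun z' => ∑ σ, w σ * s (σ z'))
        fun z' h₁ h₂ => hsymm (fun _ j => s j) z z' hzx hzy h₁ h₂
      have hzero : ∑ z', ∑ σ, w σ * s (σ z') = 0 := by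
        rw [sum_comm]
        simp only [← mul_sum, fun σ : Equiv.Perm (Fin m) => Equiv.sum_comp σ s]
        rw [← sum_mul, hw0, zero_mul]
      rw [hzero] at htot
      simp only [hwx, hwy] at htot ⊢
      have hpos : 0 < c * (m * ((m - 2) * ∑ i, q i * s i)) :=
        mul_pos hc (mul_pos (by linarith) (mul_pos (by linarith) hqs))
      refine pos_of_mul_pos_right (a := (m : ℝ) - 2) ?_ (by linarith)
      linarith
  · have hmargin : ∑ σ, w σ * rankSign (σ x) (σ z) =
        2 * c * (((m : ℝ) - 1) * ∑ i, q i * bordaVec m i - ∑ i, v i * bordaVec m i) := by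
      have hy : ∑ σ, w σ * rankSign (σ x) (σ y) =
          2 * c * (((m : ℝ) - 1) * ∑ i, q i * bordaVec m i - ∑ i, v i * bordaVec m i) := by
        rw [hpair fun i j => (q i + v j + γ * a i j) * rankSign i j]
        simp only [rankSign_self, mul_zero, sum_const_zero, sub_zero]
        simp only [add_mul _ (γ * _), sum_add_distrib, mul_assoc γ, ← mul_sum, hasign]
        rw [hγ]
        ring
      rcases eq_or_ne z y with rfl | hzy
      · exact hy
      · have htot := sum_eq_add_add_mul hxy (z := z)
          (fun z' => ∑ σ, w σ * rankSign (σ x) (σ z'))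
          fun z' h₁ h₂ => hsymm rankSign z z' hzx hzy h₁ h₂
        have hborda : ∑ z', ∑ σ, w σ * rankSign (σ x) (σ z') =
            ((m : ℝ) - 1) * (2 * ∑ σ, w σ * bordaVec m (σ x)) := by
          rw [sum_comm]
          have h : ∀ σ : Equiv.Perm (Fin m), ∑ z', w σ * rankSign (σ x) (σ z') =
              ((m : ℝ) - 1) * (2 * (w σ * bordaVec m (σ x)) - w σ) := by
            intro σ
            rw [← mul_sum, Equiv.sum_comp σ fun j => rankSign (σ x) j,
              sum_rankSign_eq_borda hm]
            ring
          simp only [h, ← mul_sum, sum_sub_distrib, hw0, sub_zero]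
        rw [hborda, hwx] at htot
        simp only [rankSign_self, mul_zero, sum_const_zero, zero_add, hy] at htot
        refine mul_left_cancel₀ (show (m : ℝ) - 2 ≠ 0 by linarith) ?_
        linarith
    simp only [fun σ : Equiv.Perm (Fin m) => rankSign_swap (σ x) (σ z), mul_neg,
      sum_neg_distrib, hmargin]
    have := mul_pos hc (sub_pos.2 hb)
    linarith
  · simp only [mul_sub, sum_sub_distrib]
    rw [hwx, hwy]
    have : 0 < c * (m * (∑ i, v i * t i - ∑ i, q i * t i)) :=
      mul_pos hc (mul_pos (by linarith) (sub_pos.2 hvt))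
    linarith

lemma isScoreVec_bordaVec {m : ℕ} (hm : 3 ≤ m) : IsScoreVec (bordaVec m) := by
  have hm' : (3 : ℝ) ≤ m := by exact_mod_cast hm
  have hpos : (0 : ℝ) < m - 1 := by linarith
  have hle : ∀ k : Fin m, ((k : ℕ) : ℝ) ≤ m - 1 := fun k => by
    have : ((k : ℕ) : ℝ) + 1 ≤ m := by exact_mod_cast k.2
    linarith
  refine ⟨fun i j hij => ?_, fun k => ⟨?_, ?_⟩, fun k hk => ?_, fun k hk => ?_⟩
  · have : ((i : ℕ) : ℝ) ≤ (j : ℕ) := by exact_mod_cast hij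
    unfold bordaVec
    gcongr
  · exact div_nonneg (by linarith [hle k]) hpos.le
  · rw [bordaVec, div_le_one hpos]
    linarith [Nat.cast_nonneg (α := ℝ) (k : ℕ)]
  · rw [bordaVec, hk, Nat.cast_zero, sub_zero, div_self hpos.ne']
  · rw [bordaVec, hk, Nat.cast_sub (by omega), Nat.cast_one, sub_self, zero_div]

/-- Two distinct rules, the first of which is not the Borda rule, are separated by some profile
at which the first but not the second selects a Condorcet loser. -/
lemma not_Lset_subset {m : ℕ} (hm : 3 ≤ m) {s t : Fin m → ℝ} (hs : IsScoreVec s)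
    (ht : IsScoreVec t) (hsB : s ≠ bordaVec m) (hst : s ≠ t) :
    ¬ Lset s ⊆ Lset t := by
  have hm' : (3 : ℝ) ≤ m := by exact_mod_cast hm
  obtain ⟨d, hd0, hds, hdt⟩ := exists_separating hm hs ht hst
  obtain ⟨u, hu0, hub, hus⟩ := exists_separating hm (isScoreVec_bordaVec hm) hs hsB.symm
  obtain ⟨K, hK, hKb⟩ : ∃ K : ℝ, 0 < K ∧
      -∑ i, d i * bordaVec m i < K * (((m : ℝ) - 2) * -∑ i, u i * bordaVec m i) := by
    have hpos : 0 < ((m : ℝ) - 2) * -∑ i, u i * bordaVec m i :=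
      mul_pos (by linarith) (neg_pos.2 hub)
    obtain ⟨N, hN⟩ := exists_lt_nsmul hpos (-∑ i, d i * bordaVec m i)
    refine ⟨N + 1, by positivity, ?_⟩
    rw [nsmul_eq_mul] at hN
    linarith
  have hKu : ∀ f : Fin m → ℝ, ∑ i, K * u i * f i = K * ∑ i, u i * f i := fun f => by
    simp only [mul_assoc, mul_sum]
  refine not_Lset_subset_of_rank_vectors hm s t (fun i => K * u i) (fun i => K * u i + d i)
    ?_ ?_ ?_ ?_ ?_ ?_
  · rw [← mul_sum, hu0, mul_zero]
  · rw [sum_add_distrib, ← mul_sum, hu0, hd0, mul_zero, zero_add]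
  · rw [hKu]
    exact mul_pos hK hus
  · simp only [add_mul, sum_add_distrib]
    linarith
  · simp only [add_mul, sum_add_distrib, hKu]
    linarith
  · simp only [add_mul, sum_add_distrib]
    linarith

/-- For any non-Borda score vector `s'`, a scoring rule `f^s` CL-dominates
`f^{s'}` iff `s` is the Borda score vector. -/
theorem cl_dominates_iff_borda
    (m : ℕ) (hm : 3 ≤ m) (s' : Fin m → ℝ) (hs' : IsScoreVec s')
    (hs'B : s' ≠ bordaVec m) (s : Fin m → ℝ) (hs : IsScoreVec s) :
    Lset s ⊂ Lset s' ↔ s = bordaVec m := by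
  have hB := isScoreVec_bordaVec hm
  constructor
  · intro h
    by_contra hsB
    rcases eq_or_ne s s' with rfl | hne
    · exact (ssubset_irrefl _) h
    · exact not_Lset_subset hm hs hs' hsB hne h.subset
  · rintro rfl
    refine ⟨?_, ?_⟩
    · rw [Lset_bordaVec hm]
      exact Set.empty_subset _
    · exact not_Lset_subset hm hs' hB hs'B hs'B
end

section
/- Let m ≥ 3. No non-Borda scoring rule CL-dominates any scoring rule: if s is a score vector with s ≠ s^B, then for every score vector s', it is not the case that L(f^s) is a proper subset of L(f^{s'}). -/
open Finset

/-- Gordan's alternative: vectors without a nontrivial nonnegative relation lie in a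
common open half-space. -/
lemma exists_forall_pos_of_no_nonneg_relation {ι κ : Type*} [Fintype ι] [Fintype κ]
    (v : ι → κ → ℝ)
    (h : ∀ w : ι → ℝ, (∀ i, 0 ≤ w i) → (∀ k, ∑ i, w i * v i k = 0) → ∀ i, w i = 0) :
    ∃ q : κ → ℝ, ∀ i, 0 < ∑ k, q k * v i k := by
  classical
  have h0 : (0 : κ → ℝ) ∉ convexHull ℝ (Set.range v) := by
    rw [convexHull_range_eq_exists_affineCombination]
    rintro ⟨t, w, hw, hw1, hw0⟩
    rw [t.affineCombination_eq_linear_combination v w hw1] at hw0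
    have hz := h (fun i => if i ∈ t then w i else 0)
      (fun i => by split_ifs with hi <;> [exact hw i hi; exact le_rfl])
      (fun k => by
        have := congrFun hw0 k
        simpa [Finset.sum_apply] using this)
    have : ∑ i ∈ t, w i = 0 := Finset.sum_eq_zero fun i hi => by simpa [hi] using hz i
    linarith
  have hc : IsClosed (convexHull ℝ (Set.range v)) :=
    ((Set.finite_range v).isCompact_convexHull ℝ).isClosed
  obtain ⟨f, u, hf0, hf⟩ := geometric_hahn_banach_point_closed (convex_convexHull ℝ _) hc h0
  refine ⟨fun k => f (Pi.single k 1), fun i => ?_⟩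
  have hi := hf (v i) (subset_convexHull ℝ _ ⟨i, rfl⟩)
  have hv : f (v i) = ∑ k, f (Pi.single k 1) * v i k := by
    conv_lhs => rw [← Finset.univ_sum_single (v i)]
    rw [map_sum]
    refine Finset.sum_congr rfl fun k _ => ?_
    have : (Pi.single k (v i k) : κ → ℝ) = v i k • Pi.single k 1 := by
      rw [← Pi.single_smul]; simp
    rw [this, map_smul, smul_eq_mul, mul_comm]
  rw [map_zero] at hf0
  rw [← hv]
  linarith

/-- Real weights can be replaced by natural ones for functionals that vanish on the
uniform weight. -/
lemma exists_nat_weights_s5 {ι κ : Type*} [Finite ι] [Fintype κ] (v : ι → κ → ℝ)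
    (hv : ∀ i, ∑ k, v i k = 0) (q : κ → ℝ) (hq : ∀ i, 0 < ∑ k, q k * v i k) :
    ∃ w : κ → ℕ, ∀ i, 0 < ∑ k, (w k : ℝ) * v i k := by
  obtain ⟨C, hC⟩ : ∃ C, ∀ k, 0 ≤ q k + C := by
    refine ⟨∑ k, |q k|, fun k => ?_⟩
    have := Finset.single_le_sum (fun k _ => abs_nonneg (q k)) (Finset.mem_univ k)
    linarith [neg_abs_le (q k)]
  have hlim : ∀ i, Filter.Tendsto
      (fun N : ℝ => ∑ k, ((⌊(q k + C) * N⌋₊ : ℝ) / N) * v i k) Filter.atTop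
      (nhds (∑ k, (q k + C) * v i k)) := fun i =>
    tendsto_finsetSum _ fun k _ => (tendsto_nat_floor_mul_div_atTop (hC k)).mul_const _
  have hpos : ∀ i, 0 < ∑ k, (q k + C) * v i k := fun i => by
    simp only [add_mul, Finset.sum_add_distrib, ← Finset.mul_sum, hv i]
    simpa using hq i
  have hev := Filter.eventually_all.2 fun i => (hlim i).eventually_const_lt (hpos i)
  obtain ⟨N, hN, hN0⟩ := (hev.and (Filter.eventually_gt_atTop 0)).exists
  refine ⟨fun k => ⌊(q k + C) * N⌋₊, fun i => ?_⟩
  have := mul_pos hN0 (hN i)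
  rw [Finset.mul_sum] at this
  refine this.trans_eq (Finset.sum_congr rfl fun k _ => ?_)
  rw [← mul_assoc, mul_div_cancel₀ _ (ne_of_gt hN0)]

/-- Every anonymous profile is realised by an actual one. -/
lemma exists_profile_of_weights {m : ℕ} (w : (Fin m ≃ Fin m) → ℕ) :
    ∃ (n : ℕ) (P : Profile m n), ∀ f : (Fin m ≃ Fin m) → ℝ,
      ∑ i, f (P i) = ∑ σ, (w σ : ℝ) * f σ := by
  let e := Fintype.equivFin (Σ σ : Fin m ≃ Fin m, Fin (w σ))
  refine ⟨_, fun i => (e.symm i).1, fun f => ?_⟩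
  rw [Equiv.sum_comp e.symm (fun p => f p.1), Fintype.sum_sigma]
  simp

lemma sum_perm_eq_zero_of_antisymm {m : ℕ} (f : Fin m → Fin m → ℝ)
    (hf : ∀ a b, f a b = -f b a) (x y : Fin m) :
    ∑ σ : Fin m ≃ Fin m, f (σ x) (σ y) = 0 := by
  have h := Equiv.sum_comp (Equiv.mulRight (Equiv.swap x y))
    (fun σ : Equiv.Perm (Fin m) => f (σ x) (σ y))
  simp only [Equiv.coe_mulRight, Equiv.Perm.mul_apply, Equiv.swap_apply_left,
    Equiv.swap_apply_right] at h
  have h' : ∑ σ : Equiv.Perm (Fin m), f (σ y) (σ x)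
      = -∑ σ : Equiv.Perm (Fin m), f (σ x) (σ y) := by
    rw [← Finset.sum_neg_distrib]
    exact Finset.sum_congr rfl fun σ _ => hf _ _
  have h'' : ∑ σ : Equiv.Perm (Fin m), f (σ x) (σ y) = 0 := by linarith
  exact h''

lemma exists_perm_three {α : Type*} [DecidableEq α] {x y z i j k : α}
    (hxy : x ≠ y) (hxz : x ≠ z) (hyz : y ≠ z) (hij : i ≠ j) (hik : i ≠ k) (hjk : j ≠ k) :
    ∃ σ : α ≃ α, σ x = i ∧ σ y = j ∧ σ z = k := by
  obtain ⟨σ, hx⟩ : ∃ σ : α ≃ α, σ x = i := ⟨Equiv.swap x i, Equiv.swap_apply_left _ _⟩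
  obtain ⟨τ, hx', hy'⟩ : ∃ τ : α ≃ α, τ x = i ∧ τ y = j := by
    refine ⟨σ.trans (Equiv.swap (σ y) j), ?_, by simp⟩
    have : i ≠ σ y := fun h => hxy (σ.injective (hx.trans h))
    simp [hx, Equiv.swap_apply_of_ne_of_ne this hij]
  refine ⟨τ.trans (Equiv.swap (τ z) k), ?_, ?_, by simp⟩
  · have : i ≠ τ z := fun h => hxz (τ.injective (hx'.trans h))
    simp [hx', Equiv.swap_apply_of_ne_of_ne this hik]
  · have : j ≠ τ z := fun h => hyz (τ.injective (hy'.trans h))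
    simp [hy', Equiv.swap_apply_of_ne_of_ne this hjk]

/-- Contribution to the majority margin of an alternative at rank `k` against one at
rank `i`. -/
noncomputable def rankMargin {m : ℕ} (k i : Fin m) : ℝ :=
  (if k ≤ i then 1 else 0) - (if i ≤ k then 1 else 0)

lemma rankMargin_self {m : ℕ} (i : Fin m) : rankMargin i i = 0 := by simp [rankMargin]

lemma rankMargin_of_lt {m : ℕ} {k i : Fin m} (h : k < i) : rankMargin k i = 1 := by
  simp [rankMargin, h.le, h]

lemma rankMargin_of_gt {m : ℕ} {k i : Fin m} (h : i < k) : rankMargin k i = -1 := by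
  simp [rankMargin, h.le, h]

lemma rankMargin_antisymm {m : ℕ} (k i : Fin m) : rankMargin k i = -rankMargin i k := by
  simp [rankMargin]

lemma sum_rankMargin {m : ℕ} (i : Fin m) :
    ∑ k, rankMargin k i = 2 * ((i : ℕ) : ℝ) - ((m : ℝ) - 1) := by
  have h1 : (univ.filter fun k => k ≤ i) = Finset.Iic i := by ext; simp
  have h2 : (univ.filter fun k => i ≤ k) = Finset.Ici i := by ext; simp
  simp only [rankMargin, Finset.sum_sub_distrib, Finset.sum_boole, h1, h2, Fin.card_Iic,
    Fin.card_Ici]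
  rw [Nat.cast_sub i.isLt.le]
  push_cast
  ring

lemma condorcetLoser_of_margin_pos {m n : ℕ} {P : Profile m n} {x : Fin m}
    (h : ∀ y, y ≠ x → 0 < ∑ i, rankMargin (P i y) (P i x)) : CondorcetLoser P x := by
  intro y hy
  have := h y hy
  simp only [rankMargin, Finset.sum_sub_distrib, Finset.sum_boole] at this
  exact_mod_cast sub_pos.1 this

/-- The functionals of a ranking that must be positive in total for `x` to be a Condorcet
loser which is the unique winner for the first score vector and loses to `z` for the second. -/
noncomputable def rankingFunctional {m : ℕ} (s s' : Fin m → ℝ) (x z : Fin m) :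
    {y // y ≠ x} ⊕ {y // y ≠ x} ⊕ Unit → (Fin m ≃ Fin m) → ℝ
  | .inl y, σ => rankMargin (σ y) (σ x)
  | .inr (.inl y), σ => s (σ x) - s (σ y)
  | .inr (.inr _), σ => s' (σ z) - s' (σ x)

lemma sum_rankingFunctional {m : ℕ} (s s' : Fin m → ℝ) (x z : Fin m)
    (i : {y // y ≠ x} ⊕ {y // y ≠ x} ⊕ Unit) : ∑ σ, rankingFunctional s s' x z i σ = 0 := by
  rcases i with y | y | _
  · exact sum_perm_eq_zero_of_antisymm rankMargin rankMargin_antisymm _ _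
  · exact sum_perm_eq_zero_of_antisymm (fun a b => s a - s b) (fun a b => by ring) _ _
  · exact sum_perm_eq_zero_of_antisymm (fun a b => s' a - s' b) (fun a b => by ring) _ _

/-- Exchanging two alternatives other than `x` in a relation between the ranking
functionals. -/
lemma relation_exchange {m : ℕ} {s s' : Fin m → ℝ} {x : Fin m} {z y : {y // y ≠ x}}
    (hzy : z ≠ y) {a g : {y // y ≠ x} → ℝ} {b : ℝ}
    (h : ∀ σ : Fin m ≃ Fin m, ∑ y, a y * rankMargin (σ y) (σ x)
      + (∑ y, g y * (s (σ x) - s (σ y)) + b * (s' (σ z) - s' (σ x))) = 0)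
    {i j k : Fin m} (hij : i ≠ j) (hik : i ≠ k) (hjk : j ≠ k) :
    (a z - a y) * (rankMargin j i - rankMargin k i)
      = ((g z - g y) * s j - b * s' j) - ((g z - g y) * s k - b * s' k) := by
  have hzy' : (z : Fin m) ≠ y := fun h => hzy (Subtype.ext h)
  obtain ⟨σ, hx, hz, hy⟩ := exists_perm_three z.2.symm y.2.symm hzy' hij hik hjk
  set τ : Fin m ≃ Fin m := (Equiv.swap (z : Fin m) y).trans σ with hτ
  have tx : τ x = i := by simp [hτ, Equiv.swap_apply_of_ne_of_ne z.2.symm y.2.symm, hx]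
  have tz : τ z = k := by simp [hτ, hy]
  have ty : τ y = j := by simp [hτ, hz]
  have tc : ∀ c : {y // y ≠ x}, c ≠ z ∧ c ≠ y → τ c = σ c := fun c hc => by
    have h1 : (c : Fin m) ≠ z := fun h => hc.1 (Subtype.ext h)
    have h2 : (c : Fin m) ≠ y := fun h => hc.2 (Subtype.ext h)
    simp [hτ, Equiv.swap_apply_of_ne_of_ne h1 h2]
  have e1 := h σ
  have e2 := h τ
  have d1 : ∑ c, (a c * rankMargin (σ c) (σ x) - a c * rankMargin (τ c) (τ x))
      = (a z - a y) * (rankMargin j i - rankMargin k i) := by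
    rw [Fintype.sum_eq_add z y hzy (fun c hc => by rw [tc c hc, hx, tx]; ring),
      hx, hz, hy, tx, tz, ty]
    ring
  have d2 : ∑ c, (g c * (s (σ x) - s (σ c)) - g c * (s (τ x) - s (τ c)))
      = -((g z - g y) * (s j - s k)) := by
    rw [Fintype.sum_eq_add z y hzy (fun c hc => by rw [tc c hc, hx, tx]; ring),
      hx, hz, hy, tx, tz, ty]
    ring
  rw [Finset.sum_sub_distrib] at d1 d2
  rw [hx, hz] at e1
  rw [tx, tz] at e2
  rw [hx, tx] at d1 d2
  linarith

lemma exists_third {m : ℕ} (hm : 3 ≤ m) (j k : Fin m) : ∃ i, i ≠ j ∧ i ≠ k := by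
  have : ({j, k} : Finset (Fin m)).card < (univ : Finset (Fin m)).card := by
    rw [Finset.card_univ, Fintype.card_fin]
    exact (Finset.card_le_two).trans_lt hm
  obtain ⟨i, -, hi⟩ := Finset.exists_mem_notMem_of_card_lt_card this
  exact ⟨i, by simpa using hi⟩

lemma relation_coefficients {m : ℕ} (hm : 3 ≤ m) {s s' : Fin m → ℝ} (hs : IsScoreVec s)
    (hs' : IsScoreVec s') (hss' : s ≠ s') {A G b : ℝ}
    (h : ∀ i j k : Fin m, i ≠ j → i ≠ k → j ≠ k →
      A * (rankMargin j i - rankMargin k i) = (G * s j - b * s' j) - (G * s k - b * s' k)) :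
    A = 0 ∧ G = 0 ∧ b = 0 := by
  have hA : A = 0 := by
    let p0 : Fin m := ⟨0, by omega⟩
    let p1 : Fin m := ⟨1, by omega⟩
    let p2 : Fin m := ⟨2, by omega⟩
    have l01 : p0 < p1 := by simp [p0, p1, Fin.lt_def]
    have l12 : p1 < p2 := by simp [p1, p2, Fin.lt_def]
    have l02 := l01.trans l12
    have e0 := h p0 p1 p2 l01.ne l02.ne l12.ne
    have e1 := h p1 p0 p2 l01.ne' l12.ne l02.ne
    have e2 := h p2 p0 p1 l02.ne' l12.ne' l01.ne
    rw [rankMargin_of_gt l01, rankMargin_of_gt l02] at e0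
    rw [rankMargin_of_lt l01, rankMargin_of_gt l12] at e1
    rw [rankMargin_of_lt l02, rankMargin_of_lt l12] at e2
    linarith
  let last : Fin m := ⟨m - 1, by omega⟩
  have hl : s last = 0 := hs.2.2.2 _ rfl
  have hl' : s' last = 0 := hs'.2.2.2 _ rfl
  have hg : ∀ j, G * s j = b * s' j := by
    intro j
    by_cases hj : j = last
    · simp [hj, hl, hl']
    · obtain ⟨i, hij, hik⟩ := exists_third hm j last
      have := h i j last hij hik hj
      rw [hA, hl, hl'] at this
      linarith
  have hGb : G = b := by
    have := hg ⟨0, by omega⟩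
    rwa [hs.2.2.1 _ rfl, hs'.2.2.1 _ rfl, mul_one, mul_one] at this
  have hb : b = 0 := by
    by_contra hb
    exact hss' (funext fun j => mul_left_cancel₀ hb (hGb ▸ hg j))
  exact ⟨hA, hGb.trans hb, hb⟩

lemma eq_borda_of_proportional {m : ℕ} (hm : 3 ≤ m) {s : Fin m → ℝ} (hs : IsScoreVec s)
    {a g S : ℝ} (hg : g ≠ 0)
    (h : ∀ i : Fin m, a * (2 * ((i : ℕ) : ℝ) - ((m : ℝ) - 1)) + g * (m * s i - S) = 0) :
    s = bordaVec m := by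
  have e0 := h ⟨0, by omega⟩
  have e1 := h ⟨m - 1, by omega⟩
  rw [hs.2.2.1 _ rfl] at e0
  rw [hs.2.2.2 _ rfl] at e1
  have hm' : (3 : ℝ) ≤ m := by exact_mod_cast hm
  have hm1 : (m : ℝ) - 1 ≠ 0 := by linarith
  have hm0 : (m : ℝ) ≠ 0 := by linarith
  simp only [Nat.cast_zero] at e0
  rw [show (((m - 1 : ℕ) : ℕ) : ℝ) = (m : ℝ) - 1 by rw [Nat.cast_sub (by omega)]; simp] at e1
  ext i
  have ei := h i
  rw [bordaVec, eq_div_iff hm1]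
  apply mul_left_cancel₀ (mul_ne_zero hg hm0)
  linear_combination (m - 1 : ℝ) * ei - (m - 1 - (i : ℕ) : ℝ) * e0 - ((i : ℕ) : ℝ) * e1

lemma rankingFunctional_no_relation {m : ℕ} (hm : 3 ≤ m) {s s' : Fin m → ℝ}
    (hs : IsScoreVec s) (hne : s ≠ bordaVec m) (hs' : IsScoreVec s') (hss' : s ≠ s')
    {x z : Fin m} (hz : z ≠ x) (w : {y // y ≠ x} ⊕ {y // y ≠ x} ⊕ Unit → ℝ)
    (h : ∀ σ, ∑ i, w i * rankingFunctional s s' x z i σ = 0) (i) : w i = 0 := by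
  set a : {y // y ≠ x} → ℝ := fun y => w (.inl y)
  set g : {y // y ≠ x} → ℝ := fun y => w (.inr (.inl y))
  set b : ℝ := w (.inr (.inr ()))
  let z' : {y // y ≠ x} := ⟨z, hz⟩
  have hrel : ∀ σ : Fin m ≃ Fin m, ∑ y, a y * rankMargin (σ y) (σ x)
      + (∑ y, g y * (s (σ x) - s (σ y)) + b * (s' (σ z') - s' (σ x))) = 0 := fun σ => by
    simpa [Fintype.sum_sum_type, rankingFunctional] using h σ
  have hcoef : ∀ y, z' ≠ y → a z' - a y = 0 ∧ g z' - g y = 0 ∧ b = 0 := fun y hy =>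
    relation_coefficients hm hs hs' hss' fun i j k hij hik hjk =>
      relation_exchange hy hrel hij hik hjk
  have hb0 : b = 0 := by
    obtain ⟨y, hyx, hyz⟩ := exists_third hm x z
    exact (hcoef ⟨y, hyx⟩ fun h => hyz (congrArg Subtype.val h).symm).2.2
  have haz : ∀ y, a y = a z' := fun y => by
    by_cases hy : z' = y
    · rw [hy]
    · linarith [(hcoef y hy).1]
  have hgz : ∀ y, g y = g z' := fun y => by
    by_cases hy : z' = y
    · rw [hy]
    · linarith [(hcoef y hy).2.1]
  have sum_ne : ∀ f : Fin m → ℝ, f x = 0 → ∑ y : {y // y ≠ x}, f y = ∑ y, f y := fun f hf => by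
    rw [Fintype.sum_eq_add_sum_subtype_ne f x, hf, zero_add]
  have hprop : ∀ i : Fin m, a z' * (2 * ((i : ℕ) : ℝ) - ((m : ℝ) - 1))
      + g z' * (m * s i - ∑ k, s k) = 0 := fun i => by
    have e := hrel (Equiv.swap x i)
    have hx : Equiv.swap x i x = i := Equiv.swap_apply_left _ _
    rw [hb0, zero_mul, add_zero, hx] at e
    simp only [haz, hgz] at e
    rw [← Finset.mul_sum, ← Finset.mul_sum,
      sum_ne (fun y => rankMargin (Equiv.swap x i y) i) (by simp [rankMargin_self]),
      sum_ne (fun y => s i - s (Equiv.swap x i y)) (by simp),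
      Equiv.sum_comp (Equiv.swap x i) (fun k => rankMargin k i),
      Equiv.sum_comp (Equiv.swap x i) (fun k => s i - s k), sum_rankMargin] at e
    simpa [Finset.sum_sub_distrib] using e
  have hg0 : g z' = 0 := by
    by_contra hg0
    exact hne (eq_borda_of_proportional hm hs hg0 hprop)
  have ha0 : a z' = 0 := by
    have e := hprop ⟨0, by omega⟩
    have hm' : (3 : ℝ) ≤ m := by exact_mod_cast hm
    rw [hg0, zero_mul, add_zero] at e
    refine (mul_eq_zero.1 e).resolve_right ?_
    simp only [Nat.cast_zero]
    linarith
  rcases i with y | y | _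
  · exact (haz y).trans ha0
  · exact (hgz y).trans hg0
  · exact hb0

lemma exists_profile_separating {m : ℕ} (hm : 3 ≤ m) {s s' : Fin m → ℝ}
    (hs : IsScoreVec s) (hne : s ≠ bordaVec m) (hs' : IsScoreVec s') (hss' : s ≠ s')
    {x z : Fin m} (hz : z ≠ x) :
    ∃ (n : ℕ) (P : Profile m n), CondorcetLoser P x ∧ (∀ y, y ≠ x → score s P y < score s P x) ∧
      score s' P x < score s' P z := by
  obtain ⟨q, hq⟩ := exists_forall_pos_of_no_nonneg_relation (rankingFunctional s s' x z)
    fun w _ hw => rankingFunctional_no_relation hm hs hne hs' hss' hz w hw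
  obtain ⟨w, hw⟩ := exists_nat_weights_s5 _ (sum_rankingFunctional s s' x z) q hq
  obtain ⟨n, P, hP⟩ := exists_profile_of_weights w
  have hpos : ∀ i, 0 < ∑ v, rankingFunctional s s' x z i (P v) := fun i => by
    rw [hP]; exact hw i
  refine ⟨n, P, condorcetLoser_of_margin_pos fun y hy => hpos (.inl ⟨y, hy⟩), fun y hy => ?_, ?_⟩
  · have := hpos (.inr (.inl ⟨y, hy⟩))
    simp only [rankingFunctional, Finset.sum_sub_distrib] at this
    exact sub_pos.1 this
  · have := hpos (.inr (.inr ()))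
    simp only [rankingFunctional, Finset.sum_sub_distrib] at this
    exact sub_pos.1 this

/-- No non-Borda scoring rule CL-dominates any scoring rule. -/
theorem non_borda_dominates_nothing
    (m : ℕ) (hm : 3 ≤ m) (s : Fin m → ℝ) (hs : IsScoreVec s)
    (hne : s ≠ bordaVec m) (s' : Fin m → ℝ) (hs' : IsScoreVec s') :
    ¬ (Lset s ⊂ Lset s') := by
  intro hsub
  have hss' : s ≠ s' := fun h => (h ▸ hsub).ne rfl
  obtain ⟨n, P, hCL, hwin, hlose⟩ := exists_profile_separating hm hs hne hs' hss'
    (x := ⟨0, by omega⟩) (z := ⟨1, by omega⟩) (by simp)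
  have hn : 0 < n := by
    rcases Nat.eq_zero_or_pos n with rfl | hn
    · simp [score] at hlose
    · exact hn
  have hmem : (⟨n, P⟩ : (n : ℕ) × Profile m n) ∈ Lset s := by
    refine ⟨hn, _, fun y => ?_, hCL⟩
    rcases eq_or_ne y ⟨0, by omega⟩ with rfl | hy
    · exact le_rfl
    · exact (hwin y hy).le
  obtain ⟨-, x, hxw, hxCL⟩ := hsub.subset hmem
  obtain rfl := hxCL.unique hCL
  exact (hxw _).not_gt hlose
end

section
/- Let s and s' be score vectors for three alternatives with 0 ≤ s(2) < s'(2) ≤ 1/2. Then there exists a preference profile ≿ on {x, y, z} such that x is a Condorcet loser at ≿, f^s(≿) = {x}, and x ∉ f^{s'}(≿). -/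
open Finset

/-- The profile with `a` voters for each of the two orders ranking alternative `0` first and
`c` voters for each of the two orders ranking it last. -/
def polarizedProfile (a c : ℕ) : Profile 3 ((a + a) + (c + c)) :=
  Fin.append
    (Fin.append (fun _ => Equiv.refl _) (fun _ => Equiv.swap 1 2))
    (Fin.append (fun _ => (finRotate 3).symm) (fun _ => Equiv.swap 0 2))

lemma sum_polarizedProfile {M : Type*} [AddCommMonoid M] (a c : ℕ) (g : Fin 3 ≃ Fin 3 → M) :
    ∑ i, g (polarizedProfile a c i) =
      (a • g (Equiv.refl _) + a • g (Equiv.swap 1 2)) +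
        (c • g (finRotate 3).symm + c • g (Equiv.swap 0 2)) := by
  simp only [polarizedProfile, Fin.sum_univ_add, Fin.append_left, Fin.append_right, sum_const,
    card_univ, Fintype.card_fin]

lemma score_polarizedProfile_zero {s : Fin 3 → ℝ} (hs : IsScoreVec s) (a c : ℕ) :
    score s (polarizedProfile a c) 0 = 2 * a := by
  have hfirst : s 0 = 1 := hs.2.2.1 0 rfl
  have hlast : s 2 = 0 := hs.2.2.2 2 rfl
  have hswap : (Equiv.swap 1 2 : Fin 3 ≃ Fin 3) 0 = 0 := by decide
  have hrot : (finRotate 3).symm 0 = 2 := by decide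
  rw [score, sum_polarizedProfile a c (fun e => s (e 0))]
  simp [hfirst, hlast, hswap, hrot]
  ring

lemma score_polarizedProfile_of_ne_zero {s : Fin 3 → ℝ} (hs : IsScoreVec s) (a c : ℕ)
    {y : Fin 3} (hy : y ≠ 0) :
    score s (polarizedProfile a c) y = a * s 1 + c * (1 + s 1) := by
  have hfirst : s 0 = 1 := hs.2.2.1 0 rfl
  have hlast : s 2 = 0 := hs.2.2.2 2 rfl
  have hrot1 : (finRotate 3).symm 1 = 0 := by decide
  have hrot2 : (finRotate 3).symm 2 = 1 := by decide
  have hswap : (Equiv.swap 0 2 : Fin 3 ≃ Fin 3) 1 = 1 := by decide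
  rw [score, sum_polarizedProfile a c (fun e => s (e y))]
  fin_cases y
  · exact absurd rfl hy
  · simp [hfirst, hlast, hrot1, hswap]
    ring
  · simp [hfirst, hlast, hrot2]
    ring

lemma condorcetLoser_polarizedProfile {a c : ℕ} (hac : a < c) :
    CondorcetLoser (polarizedProfile a c) 0 := by
  intro y hy
  rw [card_filter, card_filter,
    sum_polarizedProfile a c (fun e => if e 0 ≤ e y then 1 else 0),
    sum_polarizedProfile a c (fun e => if e y ≤ e 0 then 1 else 0)]
  have h : ∀ y : Fin 3, y ≠ 0 →
      (0 < y ∧ Equiv.swap 1 2 0 < Equiv.swap 1 2 y) ∧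
      ((finRotate 3).symm y < (finRotate 3).symm 0 ∧
        Equiv.swap 0 2 y < Equiv.swap 0 2 0) := by
    decide
  obtain ⟨⟨h₁, h₂⟩, h₃, h₄⟩ := h y hy
  simp only [Equiv.refl_apply, h₁.le, h₂.le, h₃.le, h₄.le, h₁.not_ge, h₂.not_ge, h₃.not_ge,
    h₄.not_ge, if_true, if_false, smul_eq_mul]
  omega

/-- Cross-multiplied rational interpolation between the values at `u < t ≤ 1/2` of the decreasing
function `v ↦ (1 - 2v) / (1 + v)`. -/
lemma exists_nat_between_one_sub_two_mul_div {u t : ℝ} (hu : 0 ≤ u) (hut : u < t)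
    (ht : t ≤ 1 / 2) :
    ∃ k e : ℕ, 0 < k ∧ 0 < e ∧ e * (1 + u) < k * (1 - 2 * u) ∧
      k * (1 - 2 * t) < e * (1 + t) := by
  have hu' : 0 < 1 + u := by linarith
  have ht' : 0 < 1 + t := by linarith
  have hlt : (1 - 2 * t) / (1 + t) < (1 - 2 * u) / (1 + u) := by
    rw [div_lt_div_iff₀ ht' hu']
    nlinarith
  obtain ⟨q, hq₁, hq₂⟩ := exists_rat_btwn hlt
  have hq : 0 < q := by
    have : (0 : ℝ) ≤ (1 - 2 * t) / (1 + t) := div_nonneg (by linarith) ht'.le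
    exact_mod_cast this.trans_lt hq₁
  have hk : (0 : ℝ) < q.den := by exact_mod_cast q.den_pos
  have hnum : ((q.num.toNat : ℕ) : ℝ) = q * q.den := by
    have h : ((q.num.toNat : ℕ) : ℤ) = q.num := Int.toNat_of_nonneg (Rat.num_pos.2 hq).le
    have h' : ((q.num.toNat : ℕ) : ℚ) = q * q.den := by
      rw [Rat.mul_den_eq_num]
      exact_mod_cast h
    exact_mod_cast h'
  rw [div_lt_iff₀ ht'] at hq₁
  rw [lt_div_iff₀ hu'] at hq₂
  refine ⟨q.den, q.num.toNat, q.den_pos, ?_, ?_, ?_⟩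
  · have := Rat.num_pos.2 hq
    omega
  · rw [hnum]
    nlinarith
  · rw [hnum]
    nlinarith

/-- Three-alternative case. -/
theorem three_case_E
    (s s' : Fin 3 → ℝ) (hs : IsScoreVec s) (hs' : IsScoreVec s')
    (h1 : 0 ≤ s 1) (h2 : s 1 < s' 1) (h3 : s' 1 ≤ 1/2) :
    ∃ n : ℕ, 0 < n ∧ ∃ P : Profile 3 n,
      CondorcetLoser P 0 ∧
      winners s P = {(0 : Fin 3)} ∧
      (0 : Fin 3) ∉ winners s' P := by
  obtain ⟨k, e, hk, he, hlt, hgt⟩ := exists_nat_between_one_sub_two_mul_div h1 h2 h3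
  have hscore : ∀ y : Fin 3, y ≠ 0 →
      score s (polarizedProfile k (k + e)) y < score s (polarizedProfile k (k + e)) 0 := by
    intro y hy
    rw [score_polarizedProfile_zero hs, score_polarizedProfile_of_ne_zero hs _ _ hy]
    push_cast
    linarith
  refine ⟨_, by omega, polarizedProfile k (k + e),
    condorcetLoser_polarizedProfile (by omega), ?_, ?_⟩
  · ext y
    rw [Set.mem_singleton_iff]
    constructor
    · intro hy
      by_contra hne
      exact (hscore y hne).not_ge (hy 0)
    · rintro rfl y
      rcases eq_or_ne y 0 with rfl | hy
      · exact le_rfl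
      · exact (hscore y hy).le
  · intro h
    have h' := h 1
    rw [score_polarizedProfile_zero hs',
      score_polarizedProfile_of_ne_zero hs' _ _ (by decide)] at h'
    push_cast at h'
    linarith
end

section
/- Let s and s' be score vectors for three alternatives with 0 ≤ s'(2) < s(2) < 1/2. Then there exists a preference profile ≿ on {x, y, z} such that x is a Condorcet loser at ≿, f^s(≿) = {x}, and x ∉ f^{s'}(≿). -/
open Finset

/-- Every assignment of multiplicities to a finite family of rankings is realized by a profile. -/
theorem exists_profile_sum_eq {m : ℕ} {ι : Type} [Fintype ι] (T : ι → (Fin m ≃ Fin m))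
    (c : ι → ℕ) :
    ∃ n : ℕ, ∃ P : Profile m n, ∀ {M : Type} [AddCommMonoid M] (g : (Fin m ≃ Fin m) → M),
      ∑ i, g (P i) = ∑ k, c k • g (T k) := by
  let e := Fintype.equivFin (Σ k, Fin (c k))
  refine ⟨_, fun i => T (e.symm i).1, fun {M} _ g => ?_⟩
  rw [Equiv.sum_comp e.symm (fun v => g (T v.1)), Fintype.sum_sigma]
  simp

/-- A finite family of integers becomes a family of natural numbers after a common shift. -/
theorem exists_nat_eq_add {ι : Type*} [Fintype ι] (p : ι → ℤ) :
    ∃ (C : ℤ) (c : ι → ℕ), ∀ k, (c k : ℤ) = p k + C := by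
  refine ⟨∑ k, |p k|, fun k => (p k + ∑ k, |p k|).toNat, fun k => Int.toNat_of_nonneg ?_⟩
  have h := Finset.single_le_sum (f := fun k => |p k|) (fun i _ => abs_nonneg (p i))
    (Finset.mem_univ k)
  have := neg_abs_le (p k)
  linarith

/-- Two rationals separating `a < b < c` can be written with a common positive denominator. -/
theorem exists_int_mul_separating {a b c : ℝ} (hab : a < b) (hbc : b < c) :
    ∃ d α β : ℤ, 0 < d ∧ a * d < α ∧ (α : ℝ) < b * d ∧ b * d < β ∧ (β : ℝ) < c * d := by
  obtain ⟨q, hq, hq'⟩ := exists_rat_btwn hab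
  obtain ⟨r, hr, hr'⟩ := exists_rat_btwn hbc
  have hqd : (0 : ℝ) < q.den := by exact_mod_cast q.den_pos
  have hrd : (0 : ℝ) < r.den := by exact_mod_cast r.den_pos
  have hqn : (q.num : ℝ) = q * q.den := by exact_mod_cast (Rat.mul_den_eq_num q).symm
  have hrn : (r.num : ℝ) = r * r.den := by exact_mod_cast (Rat.mul_den_eq_num r).symm
  have hd := mul_pos hqd hrd
  have hα : (q.num : ℝ) * r.den = q * (q.den * r.den) := by rw [hqn]; ring
  have hβ : (r.num : ℝ) * q.den = r * (q.den * r.den) := by rw [hrn]; ring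
  refine ⟨q.den * r.den, q.num * r.den, r.num * q.den, by exact_mod_cast hd, ?_, ?_, ?_, ?_⟩ <;>
    push_cast <;> simp only [hα, hβ] <;> gcongr

/-- The six rankings of three alternatives, each sending an alternative to its rank. -/
def rankings : Fin 6 → (Fin 3 ≃ Fin 3) :=
  ![Equiv.refl _, Equiv.swap 1 2, Equiv.swap 0 1, finRotate 3, (finRotate 3).symm,
    Equiv.swap 0 2]

/-- Three-alternative case. -/
theorem three_case_F
    (s s' : Fin 3 → ℝ) (hs : IsScoreVec s) (hs' : IsScoreVec s')
    (h1 : 0 ≤ s' 1) (h2 : s' 1 < s 1) (h3 : s 1 < 1/2) :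
    ∃ n : ℕ, 0 < n ∧ ∃ P : Profile 3 n,
      CondorcetLoser P 0 ∧
      winners s P = {(0 : Fin 3)} ∧
      (0 : Fin 3) ∉ winners s' P := by
  obtain ⟨d, α, β, hd, hα', hα, hβ, hβ'⟩ := exists_int_mul_separating h2 h3
  have hβd : 2 * β < d := by
    have : (2 * β : ℝ) < d := by linarith
    exact_mod_cast this
  have hαβ : α < β := by exact_mod_cast hα.trans hβ
  -- The score difference of `0` over `1` is a positive multiple of `K * (d * u - α)`,
  -- that of `0` over `2` a positive multiple of `L * (β - d * u)`.
  obtain ⟨K, hK⟩ : ∃ K : ℤ, K = d - 2 * β := ⟨_, rfl⟩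
  obtain ⟨L, hL⟩ : ∃ L : ℤ, L = 2 * (d - 2 * α) := ⟨_, rfl⟩
  have hKpos : 0 < K := by linarith
  have hLpos : 0 < L := by linarith
  obtain ⟨p, hp⟩ : ∃ p, p = 2 * L * β - 2 * K * d - L * d + K * α := ⟨_, rfl⟩
  obtain ⟨q, hq⟩ : ∃ q, q = 2 * L * d - 2 * K * α - L * β + K * d := ⟨_, rfl⟩
  obtain ⟨C, c, hc⟩ := exists_nat_eq_add
    (![p, q, 0, 0, 3 * d * L - q, -(3 * d * K) - p] : Fin 6 → ℤ)
  obtain ⟨n, P, hP⟩ := exists_profile_sum_eq rankings c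
  have c0 : (c 0 : ℤ) = p + C := hc 0
  have c1 : (c 1 : ℤ) = q + C := hc 1
  have c2 : (c 2 : ℤ) = 0 + C := hc 2
  have c3 : (c 3 : ℤ) = 0 + C := hc 3
  have c4 : (c 4 : ℤ) = 3 * d * L - q + C := hc 4
  have c5 : (c 5 : ℤ) = -(3 * d * K) - p + C := hc 5
  have hmargin : (c 0 + c 1 + c 2 : ℤ) < c 3 + c 4 + c 5 := by
    have h : 0 < K * (d - 2 * α) := mul_pos hKpos (by linarith)
    rw [c0, c1, c2, c3, c4, c5, hp, hq, hL]
    subst hK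
    nlinarith [mul_pos hd h]
  have hcard (a b : Fin 3) : (univ.filter fun i => P i a ≤ P i b).card =
      ∑ k, c k • (if rankings k a ≤ rankings k b then 1 else 0) := by
    rw [Finset.card_filter]
    exact hP (fun σ => if σ a ≤ σ b then 1 else 0)
  have hneg : (-1 : Fin 3) = 2 := rfl
  have hloser : CondorcetLoser P 0 := by
    intro y hy
    rw [hcard, hcard]
    fin_cases y
    · exact absurd rfl hy
    all_goals
      simp [Fin.sum_univ_six, rankings, Equiv.swap_apply_def, hneg]
      omega
  have hscore (u : Fin 3 → ℝ) (a : Fin 3) : score u P a = ∑ k, c k • u (rankings k a) :=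
    hP (fun σ => u (σ a))
  have hcast (k) : (c k : ℝ) = ((c k : ℤ) : ℝ) := by norm_cast
  have hdiff₁ (u : Fin 3 → ℝ) (hu : IsScoreVec u) :
      score u P 0 - score u P 1 = 3 * K * (u 1 * d - α) := by
    have hu0 : u 0 = 1 := hu.2.2.1 0 rfl
    have hu2 : u 2 = 0 := hu.2.2.2 2 rfl
    rw [hscore, hscore]
    simp [Fin.sum_univ_six, rankings, Equiv.swap_apply_def, hneg, hu0, hu2]
    simp only [hcast, c0, c1, c2, c3, c4, c5, hp, hq]
    push_cast
    ring
  have hdiff₂ (u : Fin 3 → ℝ) (hu : IsScoreVec u) :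
      score u P 0 - score u P 2 = 3 * L * (β - u 1 * d) := by
    have hu0 : u 0 = 1 := hu.2.2.1 0 rfl
    have hu2 : u 2 = 0 := hu.2.2.2 2 rfl
    rw [hscore, hscore]
    simp [Fin.sum_univ_six, rankings, Equiv.swap_apply_def, hneg, hu0, hu2]
    simp only [hcast, c0, c1, c2, c3, c4, c5, hp, hq]
    push_cast
    ring
  have hK' : (0 : ℝ) < 3 * K := by exact_mod_cast mul_pos three_pos hKpos
  have hL' : (0 : ℝ) < 3 * L := by exact_mod_cast mul_pos three_pos hLpos
  have hlt₁ : score s P 1 < score s P 0 := by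
    have := mul_pos hK' (sub_pos.2 hα)
    linarith [hdiff₁ s hs]
  have hlt₂ : score s P 2 < score s P 0 := by
    have := mul_pos hL' (sub_pos.2 hβ)
    linarith [hdiff₂ s hs]
  have hlt' : score s' P 0 < score s' P 1 := by
    have := mul_pos hK' (sub_pos.2 hα')
    linarith [hdiff₁ s' hs']
  refine ⟨n, ?_, P, hloser, ?_, fun h => (h 1).not_gt hlt'⟩
  · rcases Nat.eq_zero_or_pos n with rfl | hn
    · simp [score] at hlt'
    · exact hn
  · ext a
    simp only [winners, Set.mem_ofPred_eq, Set.mem_singleton_iff]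
    constructor
    · intro h
      fin_cases a
      · rfl
      · exact absurd (h 0) hlt₁.not_ge
      · exact absurd (h 0) hlt₂.not_ge
    · rintro rfl y
      fin_cases y
      exacts [le_rfl, hlt₁.le, hlt₂.le]
end
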